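/- Suppose that for some λ < 0 and p ∈ (0,1), the sequence {X_n} ⊂ C⁰(ℝ_+, S) is a (λ, τ_n, p)-pseudo-trajectory sequence for the flow Φ. Then there exist β > 0 and n₀ ∈ ℕ such that for all n ≥ n₀ and all integers m with n^p ≤ m ≤ n, one has ‖X_n(τ_m) − θ*‖ ≤ exp(−β τ_m). -/

import Mathlib

open MeasureTheory ProbabilityTheory Filter Finset Matrix Topology

noncomputable section

namespace QSDPaper

/-- The simplex of probability vectors on `Fin d`, identified with `𝒫(Δ°)`. -/
def simplex (d : ℕ) : Set (Fin d → ℝ) :=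
  {v | (∀ i, 0 ≤ v i) ∧ ∑ i, v i = 1}

/-- The transition kernel `K[ν]` on `Δ° = Fin d`.  The full state space is
`Fin (d+1)`, with absorbing state `0` and `Δ°` embedded via `Fin.succ`;
`K[ν]_{x,y} = P_{x,y} + P_{x,0} ν(y)`. -/
def Kmat {d : ℕ} (P : Matrix (Fin (d + 1)) (Fin (d + 1)) ℝ) (ν : Fin d → ℝ) :
    Matrix (Fin d) (Fin d) ℝ :=
  Matrix.of fun x y => P x.succ y.succ + P x.succ 0 * ν y

/-- Standing assumptions: `P` is a stochastic matrix with absorbing state `0`,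
`Δ°` is an irreducible class, absorption is possible from `Δ°`, and for every
`ν` in the simplex, `pi ν` is the unique invariant distribution of `K[ν]`. -/
structure Setup (d : ℕ) (P : Matrix (Fin (d + 1)) (Fin (d + 1)) ℝ)
    (pi : (Fin d → ℝ) → Fin d → ℝ) : Prop where
  P_nonneg : ∀ x y, 0 ≤ P x y
  P_rowsum : ∀ x, ∑ y, P x y = 1
  P_absorb : P 0 0 = 1
  P_irred : ∀ x y : Fin d, ∃ n : ℕ,
    0 < ((Matrix.of fun x y : Fin d => P x.succ y.succ) ^ n) x y
  P_killed : ∃ x : Fin d, 0 < P x.succ 0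
  pi_mem : ∀ ν ∈ simplex d, pi ν ∈ simplex d
  pi_invariant : ∀ ν ∈ simplex d, ∀ y, ∑ x, pi ν x * Kmat P ν x y = pi ν y
  pi_unique : ∀ ν ∈ simplex d, ∀ w ∈ simplex d,
    (∀ y, ∑ x, w x * Kmat P ν x y = w y) → w = pi ν

/-- `θs` is the unique quasi-stationary distribution, i.e. the unique fixed
point of `pi` in the simplex. -/
structure IsQSD (d : ℕ) (P : Matrix (Fin (d + 1)) (Fin (d + 1)) ℝ)
    (pi : (Fin d → ℝ) → Fin d → ℝ) (θs : Fin d → ℝ) : Prop where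
  mem : θs ∈ simplex d
  fixed : pi θs = θs
  unique : ∀ w ∈ simplex d, pi w = w → w = θs

/-- Step sizes: `gam γs k = γ*/(k - 1 + N*)` with `N* = ⌊γ*⌋ + 1`, so that
`γ_{k+1} = γ*/(k + N*)` for `k ≥ 0`. -/
def gam (γs : ℝ) (k : ℕ) : ℝ := γs / ((k : ℝ) - 1 + (⌊γs⌋₊ + 1 : ℕ))

/-- Algorithm update times `τ_k = γ_1 + ⋯ + γ_k`. -/
def tau (γs : ℝ) (k : ℕ) : ℝ := ∑ j ∈ Finset.range k, gam γs (j + 1)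

/-- `m(t) = sup {k : τ_k ≤ t}`. -/
def mfn (γs : ℝ) (t : ℝ) : ℕ := sSup {k | tau γs k ≤ t}

/-- `t_{n,j} = τ_{⌊n^p⌋}/2 + j T`. -/
def tnj (γs p T : ℝ) (n j : ℕ) : ℝ := tau γs ⌊(n : ℝ) ^ p⌋₊ / 2 + (j : ℝ) * T

/-- `L_n = ⌊(τ_n - τ_{⌊n^p⌋}/2)/T⌋ + 1`. -/
def Lfn (γs p T : ℝ) (n : ℕ) : ℕ := ⌊(tau γs n - tau γs ⌊(n : ℝ) ^ p⌋₊ / 2) / T⌋₊ + 1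

/-- `{X_n}` is a `(λ, τ_n, p)`-pseudo-trajectory sequence (PTS) for the flow `Φ`:
for all `T > 0` and `ε > 0`, eventually in `n`, for all `0 ≤ j ≤ L_n` one has
`sup_{0 ≤ u ≤ 2T} ‖X_n(t_{n,j} + u) - Φ_u(X_n(t_{n,j}))‖ ≤ exp((λ+ε) t_{n,j})`. -/
def IsPTS {d : ℕ} (γs lam p : ℝ) (Φ : ℝ → (Fin d → ℝ) → Fin d → ℝ)
    (Xs : ℕ → ℝ → Fin d → ℝ) : Prop :=
  ∀ T > (0 : ℝ), ∀ ε > (0 : ℝ), ∃ n0 : ℕ, ∀ n ≥ n0, ∀ j : ℕ, j ≤ Lfn γs p T n →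
    ∀ u ∈ Set.Icc (0 : ℝ) (2 * T),
      ‖Xs n (tnj γs p T n j + u) - Φ u (Xs n (tnj γs p T n j))‖ ≤
        Real.exp ((lam + ε) * tnj γs p T n j)

theorem pow_apply_nonneg {ι : Type*} [Fintype ι] [DecidableEq ι] {Q : Matrix ι ι ℝ}
    (hQ : ∀ x y, 0 ≤ Q x y) (n : ℕ) : ∀ x y, 0 ≤ (Q ^ n) x y := by
  induction n with
  | zero => intro x y; rw [pow_zero, Matrix.one_apply]; split_ifs <;> norm_num
  | succ k ih =>
    intro x y
    rw [pow_succ, Matrix.mul_apply]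
    exact Finset.sum_nonneg fun z _ => mul_nonneg (ih x z) (hQ z y)

/-- A nonnegative vector that is subinvariant for an irreducible, strictly substochastic matrix
vanishes. -/
theorem eq_zero_of_le_vecMul {ι : Type*} [Fintype ι] [DecidableEq ι] {Q : Matrix ι ι ℝ} {q : ι → ℝ}
    (hQ : ∀ x y, 0 ≤ Q x y) (hq : ∀ x, 0 ≤ q x) (hrow : ∀ x, ∑ y, Q x y + q x = 1)
    (hirr : ∀ x y, ∃ n : ℕ, 0 < (Q ^ n) x y) (hq0 : ∃ x, 0 < q x)
    {u : ι → ℝ} (hu : ∀ x, 0 ≤ u x) (h : ∀ y, u y ≤ (u ᵥ* Q) y) : u = 0 := by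
  have hsum : ∑ y, (u ᵥ* Q) y + ∑ x, u x * q x = ∑ x, u x := by
    simp only [Matrix.vecMul, dotProduct]
    rw [Finset.sum_comm, ← Finset.sum_add_distrib]
    refine Finset.sum_congr rfl fun x _ => ?_
    rw [← Finset.mul_sum, ← mul_add, hrow, mul_one]
  have hle : ∑ y, u y ≤ ∑ y, (u ᵥ* Q) y := Finset.sum_le_sum fun y _ => h y
  have hnn : ∀ x ∈ Finset.univ, 0 ≤ u x * q x := fun x _ => mul_nonneg (hu x) (hq x)
  have huq : ∑ x, u x * q x = 0 := by
    have := Finset.sum_nonneg hnn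
    linarith
  have heq : u ᵥ* Q = u := by
    have := (Finset.sum_eq_sum_iff_of_le (s := Finset.univ) fun y _ => h y).1 (by linarith)
    ext y
    exact (this y (Finset.mem_univ y)).symm
  have hpow : ∀ n : ℕ, u ᵥ* Q ^ n = u := by
    intro n
    induction n with
    | zero => simp
    | succ k ih => rw [pow_succ, ← Matrix.vecMul_vecMul, ih, heq]
  have hQn := pow_apply_nonneg hQ
  obtain ⟨z, hz⟩ := hq0
  have huz : u z = 0 := by
    have := (Finset.sum_eq_zero_iff_of_nonneg hnn).1 huq z (Finset.mem_univ z)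
    exact (mul_eq_zero.1 this).resolve_right hz.ne'
  ext x
  obtain ⟨n, hn⟩ := hirr x z
  have h1 : u x * (Q ^ n) x z ≤ u z := by
    conv_rhs => rw [← hpow n]
    simp only [Matrix.vecMul, dotProduct]
    exact Finset.single_le_sum (f := fun w => u w * (Q ^ n) w z)
      (fun w _ => mul_nonneg (hu w) (hQn n w z)) (Finset.mem_univ x)
  rw [huz] at h1
  have := hu x
  simp only [Pi.zero_apply]
  nlinarith

/-- For an irreducible, strictly substochastic matrix `Q` the potential matrix `(1 - Q)⁻¹` exists
and has positive entries. -/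
theorem isUnit_det_and_inv_pos {ι : Type*} [Fintype ι] [DecidableEq ι] {Q : Matrix ι ι ℝ}
    {q : ι → ℝ}
    (hQ : ∀ x y, 0 ≤ Q x y) (hq : ∀ x, 0 ≤ q x) (hrow : ∀ x, ∑ y, Q x y + q x = 1)
    (hirr : ∀ x y, ∃ n : ℕ, 0 < (Q ^ n) x y) (hq0 : ∃ x, 0 < q x) :
    IsUnit (1 - Q).det ∧ ∀ x y, 0 < (1 - Q)⁻¹ x y := by
  have hzero : ∀ {u : ι → ℝ}, (∀ x, 0 ≤ u x) → (∀ y, u y ≤ (u ᵥ* Q) y) → u = 0 :=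
    fun hu h => eq_zero_of_le_vecMul hQ hq hrow hirr hq0 hu h
  have hdet : IsUnit (1 - Q).det := by
    rw [isUnit_iff_ne_zero]
    intro h0
    obtain ⟨w, hw0, hw⟩ := Matrix.exists_vecMul_eq_zero_iff.2 h0
    rw [Matrix.vecMul_sub, Matrix.vecMul_one, sub_eq_zero] at hw
    have : (fun x => |w x|) = 0 := by
      refine hzero (fun x => abs_nonneg _) fun y => ?_
      conv_lhs => rw [hw]
      simp only [Matrix.vecMul, dotProduct]
      refine (Finset.abs_sum_le_sum_abs _ _).trans (le_of_eq ?_)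
      refine Finset.sum_congr rfl fun x _ => ?_
      rw [abs_mul, abs_of_nonneg (hQ x y)]
    apply hw0
    ext x
    exact abs_eq_zero.1 (congrFun this x)
  refine ⟨hdet, fun x => ?_⟩
  set a : ι → ℝ := (1 - Q)⁻¹ x with ha
  have hrec : ∀ y, a y = (a ᵥ* Q) y + (1 : Matrix ι ι ℝ) x y := by
    intro y
    have h1 : ((1 - Q)⁻¹ * (1 - Q)) x y = (1 : Matrix ι ι ℝ) x y := by
      rw [Matrix.nonsing_inv_mul _ hdet]
    rw [mul_sub, mul_one, Matrix.sub_apply, Matrix.mul_apply] at h1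
    simp only [Matrix.vecMul, dotProduct]
    linarith
  have hone : ∀ y, 0 ≤ (1 : Matrix ι ι ℝ) x y := by
    intro y; rw [Matrix.one_apply]; split_ifs <;> norm_num
  have hneg : (fun y => max (-a y) 0) = 0 := by
    refine hzero (fun y => le_max_right _ _) fun y => ?_
    simp only [Matrix.vecMul, dotProduct]
    refine max_le ?_ (Finset.sum_nonneg fun z _ => mul_nonneg (le_max_right _ _) (hQ z y))
    rw [hrec y]
    simp only [Matrix.vecMul, dotProduct]
    have : -∑ z, a z * Q z y ≤ ∑ z, max (-a z) 0 * Q z y := by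
      rw [← Finset.sum_neg_distrib]
      refine Finset.sum_le_sum fun z _ => ?_
      rw [← neg_mul]
      exact mul_le_mul_of_nonneg_right (le_max_left _ _) (hQ z y)
    linarith [hone y]
  have hnn : ∀ y, 0 ≤ a y := by
    intro y
    have := congrFun hneg y
    simp only [Pi.zero_apply] at this
    linarith [le_max_left (-a y) 0]
  have hx : 0 < a x := by
    rw [hrec x, Matrix.one_apply_eq]
    have : 0 ≤ (a ᵥ* Q) x := Finset.sum_nonneg fun z _ => mul_nonneg (hnn z) (hQ z x)
    linarith
  have hstep : ∀ n : ℕ, ∀ y, (a ᵥ* Q ^ n) y ≤ a y := by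
    intro n
    induction n with
    | zero => intro y; simp
    | succ k ih =>
      intro y
      rw [pow_succ, ← Matrix.vecMul_vecMul]
      have : ((a ᵥ* Q ^ k) ᵥ* Q) y ≤ (a ᵥ* Q) y :=
        Finset.sum_le_sum fun z _ => mul_le_mul_of_nonneg_right (ih z) (hQ z y)
      linarith [hrec y, hone y]
  have hQn := pow_apply_nonneg hQ
  intro y
  obtain ⟨n, hn⟩ := hirr x y
  refine lt_of_lt_of_le (mul_pos hx hn) (le_trans ?_ (hstep n y))
  exact Finset.single_le_sum (f := fun w => a w * (Q ^ n) w y)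
    (fun w _ => mul_nonneg (hnn w) (hQn n w y)) (Finset.mem_univ x)

/-- A positive matrix with a positive left eigenvector has a positive right eigenvector for the
same eigenvalue, normalised against the left one. -/
theorem exists_pos_right_eigenvector {ι : Type*} [Fintype ι] [DecidableEq ι] {A : Matrix ι ι ℝ}
    (hA : ∀ x y, 0 < A x y) {θ : ι → ℝ} (hθ : ∀ x, 0 < θ x) (hθ0 : θ ≠ 0) {κ : ℝ} (hκ : 0 < κ)
    (heig : ∀ y, ∑ x, θ x * A x y = κ * θ y) :
    ∃ φ : ι → ℝ, (∀ x, 0 < φ x) ∧ (∀ x, ∑ y, A x y * φ y = κ * φ x) ∧ ∑ x, θ x * φ x = 1 := by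
  have hdet : (A - κ • (1 : Matrix ι ι ℝ)).det = 0 := by
    refine Matrix.exists_vecMul_eq_zero_iff.1 ⟨θ, hθ0, ?_⟩
    ext y
    rw [Matrix.vecMul_sub, Matrix.vecMul_smul, Matrix.vecMul_one]
    simp only [Pi.sub_apply, Pi.smul_apply, smul_eq_mul, Pi.zero_apply, Matrix.vecMul, dotProduct,
      heig, sub_self]
  obtain ⟨w, hw0, hw⟩ := Matrix.exists_mulVec_eq_zero_iff.2 hdet
  have hwe : ∀ x, ∑ y, A x y * w y = κ * w x := by
    intro x
    have := congrFun hw x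
    rw [Matrix.sub_mulVec, Matrix.smul_mulVec, Matrix.one_mulVec] at this
    simp only [Pi.sub_apply, Pi.smul_apply, smul_eq_mul, Pi.zero_apply, Matrix.mulVec,
      dotProduct] at this
    linarith
  have hle : ∀ x ∈ Finset.univ, θ x * (κ * |w x|) ≤ θ x * ∑ y, A x y * |w y| := by
    intro x _
    refine mul_le_mul_of_nonneg_left ?_ (hθ x).le
    calc κ * |w x| = |∑ y, A x y * w y| := by rw [hwe, abs_mul, abs_of_pos hκ]
      _ ≤ ∑ y, |A x y * w y| := Finset.abs_sum_le_sum_abs _ _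
      _ = ∑ y, A x y * |w y| := by
        refine Finset.sum_congr rfl fun y _ => ?_
        rw [abs_mul, abs_of_pos (hA x y)]
  have hsum : ∑ x, θ x * (κ * |w x|) = ∑ x, θ x * ∑ y, A x y * |w y| := by
    simp only [Finset.mul_sum]
    rw [Finset.sum_comm]
    refine Finset.sum_congr rfl fun y _ => ?_
    simp only [← mul_assoc]
    rw [← Finset.sum_mul, heig]
    ring
  have habs : ∀ x, ∑ y, A x y * |w y| = κ * |w x| := fun x =>
    (mul_left_cancel₀ (hθ x).ne'
      ((Finset.sum_eq_sum_iff_of_le hle).1 hsum x (Finset.mem_univ x))).symm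
  obtain ⟨z, hz⟩ : ∃ z, w z ≠ 0 := Function.ne_iff.1 hw0
  have hpos : ∀ x, 0 < |w x| := by
    intro x
    have : 0 < κ * |w x| := by
      rw [← habs x]
      exact Finset.sum_pos' (fun y _ => mul_nonneg (hA x y).le (abs_nonneg _))
        ⟨z, Finset.mem_univ z, mul_pos (hA x z) (abs_pos.2 hz)⟩
    exact pos_of_mul_pos_right this hκ.le
  have hs : 0 < ∑ x, θ x * |w x| :=
    Finset.sum_pos (fun x _ => mul_pos (hθ x) (hpos x)) ⟨z, Finset.mem_univ z⟩
  refine ⟨fun x => |w x| / ∑ x, θ x * |w x|, fun x => div_pos (hpos x) hs, fun x => ?_, ?_⟩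
  · simp only [← mul_div_assoc]
    rw [← Finset.sum_div, habs]
  · simp only [← mul_div_assoc]
    rw [← Finset.sum_div, div_self hs.ne']

theorem exists_pos_le_of_finite {ι : Type*} [Finite ι] {f : ι → ℝ} (hf : ∀ i, 0 < f i) :
    ∃ δ > 0, ∀ i, δ ≤ f i := by
  cases isEmpty_or_nonempty ι
  · exact ⟨1, one_pos, fun i => isEmptyElim i⟩
  · obtain ⟨i, hi⟩ := Finite.exists_min f
    exact ⟨f i, hf i, hi⟩

/-- Spectral gap in the weighted supremum norm, on the hyperplane annihilated by the invariant
functional. -/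
theorem abs_sum_mul_le_of_gap {d : ℕ} {A : Matrix (Fin d) (Fin d) ℝ} {θs φ : Fin d → ℝ} {κ δ : ℝ}
    (hθs : ∀ x, 0 < θs x) (heigL : ∀ y, ∑ x, θs x * A x y = κ * θs y)
    (hnorm : ∑ x, θs x * φ x = 1) (hδ : ∀ x y, δ * (φ x * θs y) ≤ A x y)
    {g : Fin d → ℝ} (hg : ∑ x, θs x * φ x * g x = 0) (i : Fin d) :
    |(∑ j, g j * θs j * A j i) / θs i| ≤ (κ - δ) * ‖g‖ := by
  rw [abs_div, abs_of_pos (hθs i), div_le_iff₀ (hθs i)]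
  have h1 : ∑ j, g j * θs j * A j i = ∑ j, g j * (θs j * (A j i - δ * (φ j * θs i))) := by
    have : ∑ j, g j * (θs j * (A j i - δ * (φ j * θs i)))
        = ∑ j, g j * θs j * A j i - δ * θs i * ∑ x, θs x * φ x * g x := by
      rw [Finset.mul_sum, ← Finset.sum_sub_distrib]
      exact Finset.sum_congr rfl fun j _ => by ring
    rw [this, hg]
    ring
  have h2 : ∑ j, θs j * (A j i - δ * (φ j * θs i)) = (κ - δ) * θs i := by
    have : ∑ j, θs j * (A j i - δ * (φ j * θs i))
        = ∑ j, θs j * A j i - δ * θs i * ∑ x, θs x * φ x := by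
      rw [Finset.mul_sum, ← Finset.sum_sub_distrib]
      exact Finset.sum_congr rfl fun j _ => by ring
    rw [this, heigL, hnorm]
    ring
  rw [h1]
  calc |∑ j, g j * (θs j * (A j i - δ * (φ j * θs i)))|
      ≤ ∑ j, |g j * (θs j * (A j i - δ * (φ j * θs i)))| := Finset.abs_sum_le_sum_abs _ _
    _ ≤ ∑ j, ‖g‖ * (θs j * (A j i - δ * (φ j * θs i))) := by
      refine Finset.sum_le_sum fun j _ => ?_
      have hn : 0 ≤ θs j * (A j i - δ * (φ j * θs i)) :=
        mul_nonneg (hθs j).le (sub_nonneg.2 (hδ j i))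
      rw [abs_mul, abs_of_nonneg hn]
      exact mul_le_mul_of_nonneg_right (norm_le_pi_norm g j) hn
    _ = (κ - δ) * ‖g‖ * θs i := by
      rw [← Finset.mul_sum, h2]
      ring

/-- The relative deviation of `ν` from `θs`, after normalising `ν` by the functional `φ`. -/
def relDev {d : ℕ} (θs φ ν : Fin d → ℝ) : Fin d → ℝ :=
  fun i => ν i / ((∑ x, ν x * φ x) * θs i) - 1

theorem sum_mul_pos_of_mem_simplex {d : ℕ} {φ ν : Fin d → ℝ} (hφ : ∀ x, 0 < φ x)
    (hν : ν ∈ simplex d) : 0 < ∑ x, ν x * φ x := by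
  obtain ⟨z, -, hz⟩ : ∃ z ∈ Finset.univ, ν z ≠ 0 :=
    Finset.exists_ne_zero_of_sum_ne_zero (by rw [hν.2]; exact one_ne_zero)
  exact Finset.sum_pos' (fun x _ => mul_nonneg (hν.1 x) (hφ x).le)
    ⟨z, Finset.mem_univ z, mul_pos (lt_of_le_of_ne (hν.1 z) hz.symm) (hφ z)⟩

theorem le_one_of_mem_simplex {d : ℕ} {ν : Fin d → ℝ} (hν : ν ∈ simplex d) (i : Fin d) :
    ν i ≤ 1 := by
  rw [← hν.2]
  exact Finset.single_le_sum (fun x _ => hν.1 x) (Finset.mem_univ i)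

theorem norm_sub_le_relDev {d : ℕ} {θs φ ν : Fin d → ℝ} (hθs : ∀ x, 0 < θs x)
    (hφ : ∀ x, 0 < φ x) (hθsm : θs ∈ simplex d) (hν : ν ∈ simplex d) :
    ‖ν - θs‖ ≤ 2 * (∑ x, φ x) * ‖relDev θs φ ν‖ := by
  set y := ∑ x, ν x * φ x with hy
  have hypos : 0 < y := sum_mul_pos_of_mem_simplex hφ hν
  set G := relDev θs φ ν with hG
  have hrep : ∀ i, ν i = y * θs i * (1 + G i) := by
    intro i
    have := (hθs i).ne'
    simp only [hG, relDev, ← hy]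
    field_simp
    ring
  have hone : y * (1 + ∑ x, θs x * G x) = 1 := by
    calc y * (1 + ∑ x, θs x * G x) = y * (∑ x, θs x + ∑ x, θs x * G x) := by rw [hθsm.2]
      _ = ∑ x, y * θs x * (1 + G x) := by
        rw [← Finset.sum_add_distrib, Finset.mul_sum]
        exact Finset.sum_congr rfl fun x _ => by ring
      _ = ∑ x, ν x := Finset.sum_congr rfl fun x _ => (hrep x).symm
      _ = 1 := hν.2
  have hyle : y ≤ ∑ x, φ x := Finset.sum_le_sum fun x _ =>
    mul_le_of_le_one_left (hφ x).le (le_one_of_mem_simplex hν x)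
  have hSG : |∑ x, θs x * G x| ≤ ‖G‖ := by
    calc |∑ x, θs x * G x| ≤ ∑ x, |θs x * G x| := Finset.abs_sum_le_sum_abs _ _
      _ ≤ ∑ x, θs x * ‖G‖ := by
        refine Finset.sum_le_sum fun x _ => ?_
        rw [abs_mul, abs_of_pos (hθs x)]
        exact mul_le_mul_of_nonneg_left (norm_le_pi_norm G x) (hθs x).le
      _ = ‖G‖ := by rw [← Finset.sum_mul, hθsm.2, one_mul]
  have hφs : 0 ≤ ∑ x, φ x := Finset.sum_nonneg fun x _ => (hφ x).le
  refine (pi_norm_le_iff_of_nonneg (by positivity)).2 fun i => ?_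
  have hdiff : (ν - θs) i = θs i * (y * (G i - ∑ x, θs x * G x)) := by
    rw [Pi.sub_apply, hrep i]
    linear_combination θs i * hone
  rw [hdiff, Real.norm_eq_abs, abs_mul, abs_mul, abs_of_pos (hθs i), abs_of_pos hypos]
  have h2 : |G i - ∑ x, θs x * G x| ≤ 2 * ‖G‖ := by
    have := abs_sub (G i) (∑ x, θs x * G x)
    have h3 : |G i| ≤ ‖G‖ := norm_le_pi_norm G i
    linarith
  calc θs i * (y * |G i - ∑ x, θs x * G x|) ≤ 1 * (y * |G i - ∑ x, θs x * G x|) :=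
        mul_le_mul_of_nonneg_right (le_one_of_mem_simplex hθsm i) (by positivity)
    _ ≤ 1 * ((∑ x, φ x) * (2 * ‖G‖)) := by gcongr
    _ = 2 * (∑ x, φ x) * ‖G‖ := by ring

theorem relDev_le_norm_sub {d : ℕ} {θs φ : Fin d → ℝ} (hθs : ∀ x, 0 < θs x)
    (hφ : ∀ x, 0 < φ x) (hθsm : θs ∈ simplex d) (hnorm : ∑ x, θs x * φ x = 1) :
    ∃ C > 0, ∀ ν ∈ simplex d, ‖relDev θs φ ν‖ ≤ C * ‖ν - θs‖ := by
  obtain ⟨a, ha, hav⟩ := exists_pos_le_of_finite hφ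
  obtain ⟨b, hb, hbv⟩ := exists_pos_le_of_finite hθs
  have hφs : 0 ≤ ∑ x, φ x := Finset.sum_nonneg fun x _ => (hφ x).le
  refine ⟨(1 + ∑ x, φ x) / (a * b), by positivity, fun ν hν => ?_⟩
  set y := ∑ x, ν x * φ x with hy
  have hypos : 0 < y := sum_mul_pos_of_mem_simplex hφ hν
  have hay : a ≤ y := by
    calc a = ∑ x, ν x * a := by rw [← Finset.sum_mul, hν.2, one_mul]
      _ ≤ y := Finset.sum_le_sum fun x _ => mul_le_mul_of_nonneg_left (hav x) (hν.1 x)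
  have h1y : |1 - y| ≤ (∑ x, φ x) * ‖ν - θs‖ := by
    have : 1 - y = -∑ x, (ν - θs) x * φ x := by
      simp only [Pi.sub_apply, sub_mul, Finset.sum_sub_distrib]
      rw [hnorm]; ring
    rw [this, abs_neg, Finset.sum_mul]
    refine (Finset.abs_sum_le_sum_abs _ _).trans (Finset.sum_le_sum fun x _ => ?_)
    rw [abs_mul, abs_of_pos (hφ x), mul_comm]
    exact mul_le_mul_of_nonneg_left (norm_le_pi_norm (ν - θs) x) (hφ x).le
  refine (pi_norm_le_iff_of_nonneg (by positivity)).2 fun i => ?_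
  have hrep : relDev θs φ ν i = ((ν - θs) i + (1 - y) * θs i) / (y * θs i) := by
    have := (hθs i).ne'
    simp only [relDev, ← hy, Pi.sub_apply]
    field_simp
    ring
  have hpos : 0 < y * θs i := mul_pos hypos (hθs i)
  rw [hrep, Real.norm_eq_abs, abs_div, abs_of_pos hpos, div_mul_eq_mul_div]
  have hnum : |(ν - θs) i + (1 - y) * θs i| ≤ (1 + ∑ x, φ x) * ‖ν - θs‖ := by
    have h3 : |(ν - θs) i| ≤ ‖ν - θs‖ := norm_le_pi_norm (ν - θs) i
    have h4 : |(1 - y) * θs i| ≤ (∑ x, φ x) * ‖ν - θs‖ := by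
      rw [abs_mul, abs_of_pos (hθs i)]
      exact (mul_le_of_le_one_right (abs_nonneg _) (le_one_of_mem_simplex hθsm i)).trans h1y
    linarith [abs_add_le ((ν - θs) i) ((1 - y) * θs i)]
  have hab : a * b ≤ y * θs i := mul_le_mul hay (hbv i) hb.le hypos.le
  gcongr

/-- Along the normalised flow of a positive matrix, the relative deviation from the left
eigenvector decays exponentially. -/
theorem norm_relDev_le_exp {d : ℕ} {A : Matrix (Fin d) (Fin d) ℝ} {θs φ : Fin d → ℝ} {κ δ c₀ : ℝ}
    (hθs : ∀ x, 0 < θs x) (hφ : ∀ x, 0 < φ x) (hκ : 0 ≤ κ) (hδ0 : 0 ≤ δ)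
    (heigL : ∀ y, ∑ x, θs x * A x y = κ * θs y) (heigR : ∀ x, ∑ y, A x y * φ y = κ * φ x)
    (hnorm : ∑ x, θs x * φ x = 1) (hδ : ∀ x y, δ * (φ x * θs y) ≤ A x y)
    {θ : ℝ → Fin d → ℝ} {c : ℝ → ℝ} (hc₀ : 0 ≤ c₀)
    (hmem : ∀ t, 0 ≤ t → θ t ∈ simplex d) (hc : ∀ t, 0 ≤ t → c₀ ≤ c t)
    (hc1 : ∀ t, 0 ≤ t → c t ≤ 1)
    (hode : ∀ t, 0 ≤ t → HasDerivAt θ (fun i => c t * ∑ j, θ t j * A j i - θ t i) t)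
    {t : ℝ} (ht : 0 ≤ t) :
    ‖relDev θs φ (θ t)‖ ≤ Real.exp (-(c₀ * δ) * t) * ‖relDev θs φ (θ 0)‖ := by
  set G : ℝ → Fin d → ℝ := fun s => relDev θs φ (θ s) with hG
  set y : ℝ → ℝ := fun s => ∑ x, θ s x * φ x with hy
  have hypos : ∀ s, 0 ≤ s → 0 < y s := fun s hs => sum_mul_pos_of_mem_simplex hφ (hmem s hs)
  have hyd : ∀ s, 0 ≤ s → HasDerivAt y ((c s * κ - 1) * y s) s := by
    intro s hs
    have h1 : HasDerivAt y (∑ x, (c s * ∑ j, θ s j * A j x - θ s x) * φ x) s :=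
      HasDerivAt.fun_sum fun x _ => ((hasDerivAt_pi.1 (hode s hs)) x).mul_const (φ x)
    convert h1 using 1
    have h2 : ∑ x, (∑ j, θ s j * A j x) * φ x = κ * y s := by
      simp only [Finset.sum_mul, hy, Finset.mul_sum]
      rw [Finset.sum_comm]
      refine Finset.sum_congr rfl fun j _ => ?_
      simp only [mul_assoc]
      rw [← Finset.mul_sum, heigR]
      ring
    have h3 : ∑ x, (c s * ∑ j, θ s j * A j x - θ s x) * φ x
        = c s * ∑ x, (∑ j, θ s j * A j x) * φ x - y s := by
      rw [Finset.mul_sum, hy, ← Finset.sum_sub_distrib]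
      exact Finset.sum_congr rfl fun x _ => by ring
    rw [h3, h2]
    ring
  have hrep : ∀ s, 0 ≤ s → ∀ i, θ s i = y s * θs i * (1 + G s i) := by
    intro s hs i
    have h1 := (hθs i).ne'
    have h2 := (hypos s hs).ne'
    simp only [hG, relDev]
    change θ s i = y s * θs i * (1 + (θ s i / (y s * θs i) - 1))
    field_simp
    ring
  have hGd : ∀ s, 0 ≤ s → HasDerivAt G
      (fun i => c s * ((∑ j, G s j * θs j * A j i) / θs i - κ * G s i)) s := by
    intro s hs
    refine hasDerivAt_pi.2 fun i => ?_
    have hpos := hypos s hs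
    have hi := hθs i
    have h1 := (((hasDerivAt_pi.1 (hode s hs)) i).div ((hyd s hs).mul_const (θs i))
      (mul_pos hpos hi).ne').sub_const 1
    refine h1.congr_deriv ?_
    have h2 : ∑ j, θ s j * A j i = y s * (κ * θs i + ∑ j, G s j * θs j * A j i) := by
      rw [← heigL, ← Finset.sum_add_distrib, Finset.mul_sum]
      refine Finset.sum_congr rfl fun j _ => ?_
      rw [hrep s hs j]
      ring
    rw [h2, hrep s hs i]
    field_simp
    ring
  have hzero : ∀ s, 0 ≤ s → ∑ x, θs x * φ x * G s x = 0 := by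
    intro s hs
    have hpos := hypos s hs
    have h1 : y s * ∑ x, θs x * φ x * G s x = y s - y s * ∑ x, θs x * φ x := by
      conv_rhs => lhs; rw [hy]
      rw [Finset.mul_sum, Finset.mul_sum, ← Finset.sum_sub_distrib]
      refine Finset.sum_congr rfl fun x _ => ?_
      rw [hrep s hs x]
      ring
    rw [hnorm, mul_one, sub_self] at h1
    exact (mul_eq_zero.1 h1).resolve_left hpos.ne'
  have hfd : ∀ s, 0 ≤ s → HasDerivAt (fun r => Real.exp (κ * r) • G r)
      (Real.exp (κ * s) • (fun i => κ * (1 - c s) * G s i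
        + c s * ((∑ j, G s j * θs j * A j i) / θs i))) s := by
    intro s hs
    have h1 : HasDerivAt (fun r : ℝ => Real.exp (κ * r)) (Real.exp (κ * s) * κ) s := by
      simpa using ((hasDerivAt_id s).const_mul κ).exp
    refine (h1.smul (hGd s hs)).congr_deriv ?_
    ext i
    simp only [Pi.add_apply, Pi.smul_apply, smul_eq_mul]
    ring
  have hbound : ∀ s ∈ Set.Ico 0 t, ‖Real.exp (κ * s) • (fun i => κ * (1 - c s) * G s i
        + c s * ((∑ j, G s j * θs j * A j i) / θs i))‖
      ≤ (κ - c₀ * δ) * ‖Real.exp (κ * s) • G s‖ + 0 := by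
    intro s hs
    have hc0' := hc s hs.1
    have hc1' := hc1 s hs.1
    rw [norm_smul, norm_smul, add_zero, mul_left_comm]
    refine mul_le_mul_of_nonneg_left ?_ (norm_nonneg _)
    have hstep : ∀ i, |κ * (1 - c s) * G s i + c s * ((∑ j, G s j * θs j * A j i) / θs i)|
        ≤ (κ - c₀ * δ) * ‖G s‖ := by
      intro i
      have h1 : |κ * (1 - c s) * G s i| ≤ κ * (1 - c s) * ‖G s‖ := by
        have hnn : 0 ≤ κ * (1 - c s) := mul_nonneg hκ (by linarith)
        rw [abs_mul, abs_of_nonneg hnn]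
        exact mul_le_mul_of_nonneg_left (norm_le_pi_norm (G s) i) hnn
      have h2 : |c s * ((∑ j, G s j * θs j * A j i) / θs i)| ≤ c s * ((κ - δ) * ‖G s‖) := by
        have hnn : 0 ≤ c s := hc₀.trans hc0'
        rw [abs_mul, abs_of_nonneg hnn]
        exact mul_le_mul_of_nonneg_left
          (abs_sum_mul_le_of_gap hθs heigL hnorm hδ (hzero s hs.1) i) hnn
      have h3 : c₀ * δ * ‖G s‖ ≤ c s * δ * ‖G s‖ := by gcongr
      linarith [abs_add_le (κ * (1 - c s) * G s i) (c s * ((∑ j, G s j * θs j * A j i) / θs i))]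
    cases isEmpty_or_nonempty (Fin d)
    · rw [Subsingleton.elim (G s) 0, norm_zero, mul_zero]
      exact (norm_eq_zero.2 (Subsingleton.elim _ _)).le
    · exact (pi_norm_le_iff_of_nonempty _).2 hstep
  have hgron := norm_le_gronwallBound_of_norm_deriv_right_le (δ := ‖G 0‖) (K := κ - c₀ * δ)
    (ε := 0) (a := 0) (b := t) (f := fun r => Real.exp (κ * r) • G r)
    (fun s hs => (hfd s hs.1).continuousAt.continuousWithinAt)
    (fun s hs => (hfd s hs.1).hasDerivWithinAt) (by simp) hbound t ⟨ht, le_rfl⟩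
  rw [gronwallBound_ε0, sub_zero, norm_smul, Real.norm_eq_abs, Real.abs_exp] at hgron
  have hexp : Real.exp ((κ - c₀ * δ) * t) = Real.exp (κ * t) * Real.exp (-(c₀ * δ) * t) := by
    rw [← Real.exp_add]; ring_nf
  rw [hexp] at hgron
  have hE := Real.exp_pos (κ * t)
  refine le_of_mul_le_mul_left (hgron.trans (le_of_eq ?_)) hE
  ring

/-- The flow of `pi - id` converges to the quasi-stationary distribution exponentially fast,
uniformly over the simplex. -/
theorem flow_contraction {d : ℕ} {P : Matrix (Fin (d + 1)) (Fin (d + 1)) ℝ}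
    {pi : (Fin d → ℝ) → Fin d → ℝ} {θs : Fin d → ℝ}
    (hS : Setup d P pi) (hQSD : IsQSD d P pi θs)
    {Φ : ℝ → (Fin d → ℝ) → Fin d → ℝ}
    (hΦ0 : ∀ ν ∈ simplex d, Φ 0 ν = ν)
    (hΦmem : ∀ ν ∈ simplex d, ∀ t : ℝ, 0 ≤ t → Φ t ν ∈ simplex d)
    (hΦode : ∀ ν ∈ simplex d, ∀ t : ℝ, 0 ≤ t →
      HasDerivAt (fun s => Φ s ν) (pi (Φ t ν) - Φ t ν) t) :
    ∃ C > 0, ∃ a > 0, ∀ ν ∈ simplex d, ∀ t : ℝ, 0 ≤ t →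
      ‖Φ t ν - θs‖ ≤ C * Real.exp (-a * t) * ‖ν - θs‖ := by
  set Q : Matrix (Fin d) (Fin d) ℝ := Matrix.of fun x y => P x.succ y.succ with hQdef
  set q : Fin d → ℝ := fun x => P x.succ 0 with hq
  have hQ : ∀ x y, 0 ≤ Q x y := fun x y => hS.P_nonneg _ _
  have hq0 : ∀ x, 0 ≤ q x := fun x => hS.P_nonneg _ _
  have hrow : ∀ x, ∑ y, Q x y + q x = 1 := by
    intro x
    rw [← hS.P_rowsum x.succ, Fin.sum_univ_succ, add_comm]
    rfl
  have hq1 : ∀ x, q x ≤ 1 := fun x => by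
    have := Finset.sum_nonneg fun y (_ : y ∈ Finset.univ) => hQ x y
    linarith [hrow x]
  obtain ⟨hdet, hApos⟩ := isUnit_det_and_inv_pos hQ hq0 hrow hS.P_irred hS.P_killed
  set A := (1 - Q)⁻¹ with hA
  set c : (Fin d → ℝ) → ℝ := fun ν => ∑ x, pi ν x * q x with hc
  have hpi : ∀ ν ∈ simplex d, ∀ i, pi ν i = c ν * ∑ j, ν j * A j i := by
    intro ν hν
    have h1 : pi ν ᵥ* (1 - Q) = c ν • ν := by
      ext y
      rw [Matrix.vecMul_sub, Matrix.vecMul_one]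
      have h2 := hS.pi_invariant ν hν y
      have h3 : ∑ x, pi ν x * Kmat P ν x y = (pi ν ᵥ* Q) y + c ν * ν y := by
        simp only [Kmat, Matrix.of_apply, Matrix.vecMul, dotProduct, hc, hQdef, hq, Finset.sum_mul]
        rw [← Finset.sum_add_distrib]
        exact Finset.sum_congr rfl fun x _ => by ring
      simp only [Pi.sub_apply, Pi.smul_apply, smul_eq_mul]
      linarith
    have h4 : pi ν = (c ν • ν) ᵥ* A := by
      rw [← h1, Matrix.vecMul_vecMul, hA, Matrix.mul_nonsing_inv _ hdet, Matrix.vecMul_one]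
    intro i
    conv_lhs => rw [h4]
    rw [Matrix.smul_vecMul]
    rfl
  have hc1 : ∀ ν ∈ simplex d, c ν ≤ 1 := by
    intro ν hν
    have hm := hS.pi_mem ν hν
    rw [← hm.2]
    exact Finset.sum_le_sum fun x _ => mul_le_of_le_one_right (hm.1 x) (hq1 x)
  have hcnn : ∀ ν ∈ simplex d, 0 ≤ c ν := fun ν hν =>
    Finset.sum_nonneg fun x _ => mul_nonneg ((hS.pi_mem ν hν).1 x) (hq0 x)
  have hcmass : ∀ ν ∈ simplex d, c ν * ∑ i, ∑ j, ν j * A j i = 1 := by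
    intro ν hν
    rw [← (hS.pi_mem ν hν).2, Finset.mul_sum]
    exact Finset.sum_congr rfl fun i _ => (hpi ν hν i).symm
  set M : ℝ := ∑ i, ∑ j, A j i with hM
  have hMnn : 0 ≤ M := Finset.sum_nonneg fun i _ => Finset.sum_nonneg fun j _ => (hApos j i).le
  have hcM : ∀ ν ∈ simplex d, 1 ≤ c ν * M := by
    intro ν hν
    rw [← hcmass ν hν]
    refine mul_le_mul_of_nonneg_left ?_ (hcnn ν hν)
    exact Finset.sum_le_sum fun i _ => Finset.sum_le_sum fun j _ =>
      mul_le_of_le_one_left (hApos j i).le (le_one_of_mem_simplex hν j)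
  have hMpos : 0 < M := by
    refine lt_of_le_of_ne hMnn fun h => ?_
    have := hcM θs hQSD.mem
    rw [← h] at this
    linarith
  have hcinv : ∀ ν ∈ simplex d, M⁻¹ ≤ c ν := fun ν hν => by
    rw [inv_eq_one_div, div_le_iff₀ hMpos]
    exact hcM ν hν
  have hcθ : 0 < c θs := (inv_pos.2 hMpos).trans_le (hcinv θs hQSD.mem)
  have hθeq : ∀ i, θs i = c θs * ∑ j, θs j * A j i := fun i => by
    have := hpi θs hQSD.mem i
    rwa [hQSD.fixed] at this
  have hθpos : ∀ i, 0 < θs i := fun i => by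
    rw [hθeq i]
    refine mul_pos hcθ (sum_mul_pos_of_mem_simplex (fun j => hApos j i) hQSD.mem)
  have hθ0 : θs ≠ 0 := by
    intro h
    have := hQSD.mem.2
    rw [h] at this
    simp at this
  have hκ : 0 < (c θs)⁻¹ := inv_pos.2 hcθ
  have heigL : ∀ y, ∑ x, θs x * A x y = (c θs)⁻¹ * θs y := fun y => by
    rw [hθeq y, inv_mul_cancel_left₀ hcθ.ne']
  obtain ⟨φ, hφ, heigR, hnorm⟩ := exists_pos_right_eigenvector hApos hθpos hθ0 hκ heigL
  obtain ⟨δ, hδ, hδA⟩ := exists_pos_le_of_finite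
    (f := fun z : Fin d × Fin d => A z.1 z.2 / (φ z.1 * θs z.2))
    fun z => div_pos (hApos _ _) (mul_pos (hφ _) (hθpos _))
  have hδA' : ∀ x y, δ * (φ x * θs y) ≤ A x y := fun x y =>
    (le_div_iff₀ (mul_pos (hφ x) (hθpos y))).1 (hδA (x, y))
  obtain ⟨C, hC, hCle⟩ := relDev_le_norm_sub hθpos hφ hQSD.mem hnorm
  have hφs : 0 ≤ ∑ x, φ x := Finset.sum_nonneg fun x _ => (hφ x).le
  refine ⟨(2 * ∑ x, φ x + 1) * C, by positivity, M⁻¹ * δ, by positivity, fun ν hν t ht => ?_⟩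
  have hdec := norm_relDev_le_exp (c₀ := M⁻¹) (θ := fun s => Φ s ν) (c := fun s => c (Φ s ν))
    hθpos hφ hκ.le hδ.le heigL heigR hnorm hδA' (inv_pos.2 hMpos).le
    (fun s hs => hΦmem ν hν s hs) (fun s hs => hcinv _ (hΦmem ν hν s hs))
    (fun s hs => hc1 _ (hΦmem ν hν s hs))
    (fun s hs => (hΦode ν hν s hs).congr_deriv (by
      ext i
      rw [Pi.sub_apply, hpi _ (hΦmem ν hν s hs)])) ht
  rw [hΦ0 ν hν] at hdec
  calc ‖Φ t ν - θs‖ ≤ 2 * (∑ x, φ x) * ‖relDev θs φ (Φ t ν)‖ :=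
        norm_sub_le_relDev hθpos hφ hQSD.mem (hΦmem ν hν t ht)
    _ ≤ (2 * ∑ x, φ x + 1) * (Real.exp (-(M⁻¹ * δ) * t) * (C * ‖ν - θs‖)) := by
        refine mul_le_mul (by linarith) (hdec.trans ?_) (norm_nonneg _) (by linarith)
        exact mul_le_mul_of_nonneg_left (hCle ν hν) (Real.exp_pos _).le
    _ = (2 * ∑ x, φ x + 1) * C * Real.exp (-(M⁻¹ * δ) * t) * ‖ν - θs‖ := by ring

theorem gam_succ_pos {γs : ℝ} (hγ : 0 < γs) (j : ℕ) : 0 < gam γs (j + 1) := by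
  unfold gam
  push_cast
  refine div_pos hγ ?_
  have : (0 : ℝ) ≤ ⌊γs⌋₊ := Nat.cast_nonneg _
  have : (0 : ℝ) ≤ j := Nat.cast_nonneg _
  linarith

theorem tau_mono {γs : ℝ} (hγ : 0 < γs) : Monotone (tau γs) := by
  refine monotone_nat_of_le_succ fun k => ?_
  unfold tau
  rw [Finset.sum_range_succ]
  linarith [gam_succ_pos hγ k]

theorem tau_nonneg {γs : ℝ} (hγ : 0 < γs) (k : ℕ) : 0 ≤ tau γs k :=
  Finset.sum_nonneg fun j _ => (gam_succ_pos hγ j).le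

theorem tendsto_tau {γs : ℝ} (hγ : 0 < γs) : Tendsto (tau γs) atTop atTop := by
  have h0 : ¬ Summable fun j : ℕ => gam γs (j + 1) := by
    intro hs
    have h1 : Summable fun j : ℕ => ((j + (⌊γs⌋₊ + 1) : ℕ) : ℝ)⁻¹ := by
      refine (hs.mul_left γs⁻¹).congr fun j => ?_
      unfold gam
      push_cast
      rw [← mul_div_assoc, inv_mul_cancel₀ hγ.ne', one_div]
      congr 1
      ring
    exact Real.not_summable_natCast_inv ((summable_nat_add_iff (⌊γs⌋₊ + 1)).1 h1)
  exact (not_summable_iff_tendsto_nat_atTop_of_nonneg fun j => (gam_succ_pos hγ j).le).1 h0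

/-- A sequence that is halved at each step up to a geometric error decays geometrically. -/
theorem le_geometric_of_half_step {e : ℕ → ℝ} {r : ℝ} (hr : 3 / 4 ≤ r) (he0 : e 0 ≤ 4) {N : ℕ}
    (hstep : ∀ j < N, e (j + 1) ≤ 1 / 2 * e j + r ^ j) : ∀ j ≤ N, e j ≤ 4 * r ^ j := by
  intro j
  induction j with
  | zero => intro _; simpa using he0
  | succ k ih =>
    intro hk
    have h1 := ih (by omega)
    have h2 := hstep k (by omega)
    have h3 : 0 ≤ r ^ k := pow_nonneg (by linarith) k
    rw [pow_succ]
    nlinarith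

/-- **Lemma (rate of convergence of pseudo-trajectory sequences).** If `{X_n}` is a
`(λ, τ_n, p)`-PTS for the flow `Φ` of `θ̇ = h(θ)` with `λ < 0`, `p ∈ (0,1)`, then there
are `β > 0` and `n₀` such that `‖X_n(τ_m) - θ*‖ ≤ exp(-β τ_m)` for all `n ≥ n₀` and
`n^p ≤ m ≤ n`. -/
theorem pts_rate
    {d : ℕ} (hd : 0 < d) (P : Matrix (Fin (d + 1)) (Fin (d + 1)) ℝ)
    (pi : (Fin d → ℝ) → Fin d → ℝ) (θs : Fin d → ℝ) (γs lam p : ℝ)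
    (hS : Setup d P pi) (hQSD : IsQSD d P pi θs) (hγpos : 0 < γs)
    (Φ : ℝ → (Fin d → ℝ) → Fin d → ℝ)
    (hΦ0 : ∀ ν ∈ simplex d, Φ 0 ν = ν)
    (hΦmem : ∀ ν ∈ simplex d, ∀ t : ℝ, 0 ≤ t → Φ t ν ∈ simplex d)
    (hΦode : ∀ ν ∈ simplex d, ∀ t : ℝ, 0 ≤ t →
      HasDerivAt (fun s => Φ s ν) (pi (Φ t ν) - Φ t ν) t)
    (Xs : ℕ → ℝ → Fin d → ℝ)
    (hXcont : ∀ n, Continuous (Xs n))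
    (hXmem : ∀ n, ∀ t : ℝ, 0 ≤ t → Xs n t ∈ simplex d)
    (hlam : lam < 0) (hp : p ∈ Set.Ioo (0 : ℝ) 1)
    (hPTS : IsPTS γs lam p Φ Xs) :
    ∃ β : ℝ, 0 < β ∧ ∃ n0 : ℕ, ∀ n ≥ n0, ∀ m : ℕ,
      (n : ℝ) ^ p ≤ (m : ℝ) → m ≤ n →
        ‖Xs n (tau γs m) - θs‖ ≤ Real.exp (-β * tau γs m) := by
  obtain ⟨hp0, -⟩ := hp
  obtain ⟨C, hC, a, ha, hflow⟩ := flow_contraction hS hQSD hΦ0 hΦmem hΦode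
  obtain ⟨T, hT, hCT⟩ : ∃ T > 0, C * Real.exp (-a * T) ≤ 1 / 2 := by
    have h1 : Tendsto (fun T : ℝ => C * Real.exp (-(a * T))) atTop (𝓝 (C * 0)) :=
      (Real.tendsto_exp_neg_atTop_nhds_zero.comp (tendsto_id.const_mul_atTop ha)).const_mul C
    rw [mul_zero] at h1
    obtain ⟨T, hT1, hT2⟩ :=
      ((h1.eventually_le_const (show (0 : ℝ) < 1 / 2 by norm_num)).and (eventually_gt_atTop 0)).exists
    exact ⟨T, hT2, by simpa only [neg_mul] using hT1⟩
  obtain ⟨b, hb, hbα, hr⟩ : ∃ b > 0, b ≤ -lam / 2 ∧ 3 / 4 ≤ Real.exp (-(b * T)) := by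
    refine ⟨min (-lam / 2) (1 / 4 / T), lt_min (by linarith) (by positivity), min_le_left _ _, ?_⟩
    have h1 : min (-lam / 2) (1 / 4 / T) * T ≤ 1 / 4 :=
      (le_div_iff₀ hT).1 (min_le_right _ _)
    linarith [Real.add_one_le_exp (-(min (-lam / 2) (1 / 4 / T) * T))]
  obtain ⟨n₁, hn₁⟩ := hPTS T hT (-lam / 2) (by linarith)
  obtain ⟨R, hR⟩ : ∃ R : ℝ, (1 + 4 * C) * Real.exp (b * T) ≤ Real.exp (b / 4 * R) := by
    have h1 : Tendsto (fun R : ℝ => Real.exp (b / 4 * R)) atTop atTop :=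
      Real.tendsto_exp_atTop.comp (tendsto_id.const_mul_atTop (by positivity))
    exact (h1.eventually_ge_atTop _).exists
  obtain ⟨K, hK⟩ := ((tendsto_tau hγpos).eventually_ge_atTop R).exists_forall_of_atTop
  obtain ⟨n₂, hn₂⟩ := (((tendsto_rpow_atTop hp0).comp
    tendsto_natCast_atTop_atTop).eventually_ge_atTop (K : ℝ)).exists_forall_of_atTop
  refine ⟨b / 4, by positivity, max n₁ n₂, fun n hn m hnm hmn => ?_⟩
  set s := tau γs ⌊(n : ℝ) ^ p⌋₊ / 2 with hs
  have hs0 : 0 ≤ s := div_nonneg (tau_nonneg hγpos _) two_pos.le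
  have hsm : 2 * s ≤ tau γs m := by
    have := tau_mono hγpos (Nat.floor_le_of_le hnm)
    linarith
  have hRm : R ≤ tau γs m := hK m (by exact_mod_cast (hn₂ n (le_of_max_le_right hn)).trans hnm)
  have ht : ∀ j : ℕ, tnj γs p T n j = s + j * T := fun j => rfl
  have ht0 : ∀ j : ℕ, 0 ≤ tnj γs p T n j := fun j => by rw [ht]; positivity
  have herr : ∀ j : ℕ, Real.exp ((lam + -lam / 2) * tnj γs p T n j) ≤
      Real.exp (-(b * T)) ^ j := by
    intro j
    rw [← Real.exp_nat_mul, Real.exp_le_exp, ht]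
    have hjT : 0 ≤ (j : ℝ) * T := by positivity
    nlinarith
  have hdev : ∀ j ≤ Lfn γs p T n, ∀ u ∈ Set.Icc (0 : ℝ) (2 * T),
      ‖Xs n (tnj γs p T n j + u) - θs‖ ≤ Real.exp (-(b * T)) ^ j
        + C * Real.exp (-a * u) * ‖Xs n (tnj γs p T n j) - θs‖ := by
    intro j hj u hu
    have h1 := (hn₁ n (le_of_max_le_left hn) j hj u hu).trans (herr j)
    have h2 := hflow _ (hXmem n _ (ht0 j)) u hu.1
    exact (norm_sub_le_norm_sub_add_norm_sub _ _ _).trans (add_le_add h1 h2)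
  have hgeom := le_geometric_of_half_step (e := fun j => ‖Xs n (tnj γs p T n j) - θs‖) hr
    (N := Lfn γs p T n) (by
      refine (pi_norm_le_iff_of_nonneg (by norm_num)).2 fun i => ?_
      have h1 := hXmem n _ (ht0 0)
      have h2 := le_one_of_mem_simplex h1 i
      have h3 := le_one_of_mem_simplex hQSD.mem i
      have h4 := h1.1 i
      have h5 := hQSD.mem.1 i
      rw [Pi.sub_apply, Real.norm_eq_abs, abs_le]
      constructor <;> linarith) (by
      intro j hj
      have h1 := hdev j hj.le T ⟨hT.le, by linarith⟩
      have h2 : tnj γs p T n (j + 1) = tnj γs p T n j + T := by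
        rw [ht, ht]; push_cast; ring
      simp only [h2]
      have h3 := mul_le_mul_of_nonneg_right hCT (norm_nonneg (Xs n (tnj γs p T n j) - θs))
      linarith)
  set J := ⌊(tau γs m - s) / T⌋₊ with hJ
  have hJL : J ≤ Lfn γs p T n := by
    refine (Nat.floor_mono ?_).trans (Nat.le_succ _)
    have := tau_mono hγpos hmn
    gcongr
  have hJ1 : (J : ℝ) * T ≤ tau γs m - s :=
    (le_div_iff₀ hT).1 (Nat.floor_le (div_nonneg (by linarith) hT.le))
  have hJ2 : tau γs m - s < (J + 1) * T := (div_lt_iff₀ hT).1 (Nat.lt_floor_add_one _)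
  have hfin := hdev J hJL (tau γs m - tnj γs p T n J)
    ⟨by rw [ht]; linarith, by rw [ht]; linarith⟩
  rw [add_sub_cancel] at hfin
  have hu : Real.exp (-a * (tau γs m - tnj γs p T n J)) ≤ 1 := by
    rw [Real.exp_le_one_iff, ht]
    nlinarith
  have hpow : Real.exp (-(b * T)) ^ J ≤ Real.exp (b * T) * Real.exp (-(b / 2) * tau γs m) := by
    rw [← Real.exp_nat_mul, ← Real.exp_add, Real.exp_le_exp]
    nlinarith
  have hR' : (1 + 4 * C) * Real.exp (b * T) ≤ Real.exp (b / 4 * tau γs m) :=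
    hR.trans (Real.exp_le_exp.2 (mul_le_mul_of_nonneg_left hRm (by positivity)))
  calc ‖Xs n (tau γs m) - θs‖
      ≤ Real.exp (-(b * T)) ^ J + C * 1 * (4 * Real.exp (-(b * T)) ^ J) := by
        refine hfin.trans (add_le_add le_rfl ?_)
        exact mul_le_mul (mul_le_mul_of_nonneg_left hu hC.le) (hgeom J hJL) (norm_nonneg _)
          (by positivity)
    _ = (1 + 4 * C) * Real.exp (-(b * T)) ^ J := by ring
    _ ≤ (1 + 4 * C) * (Real.exp (b * T) * Real.exp (-(b / 2) * tau γs m)) := by gcongr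
    _ = (1 + 4 * C) * Real.exp (b * T) * Real.exp (-(b / 2) * tau γs m) := by ring
    _ ≤ Real.exp (b / 4 * tau γs m) * Real.exp (-(b / 2) * tau γs m) := by gcongr
    _ = Real.exp (-(b / 4) * tau γs m) := by
        rw [← Real.exp_add]
        congr 1
        ring

end QSDPaper
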